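/- arXiv:2111.08198 — 5 statements merged into one kernel-verified Lean document; each statement's English description precedes it below -/
import Mathlib

section
/- For every ρ ∈ [0,4] there exists a constant C > 0 such that for all τ > 0, all λ > 0, and all t > 0 one has |ψ_{τ,λ}(t)| ≤ C · t^{−ρ/4} · λ^{−ρ/2}, where ψ_{τ,λ}(t) = exp(−t·λ²) − (1 + τ·λ²)^{−k} with k = ⌊t/τ⌋ + 1. -/
open Real

theorem inv_one_add_le_rpow_neg {x s : ℝ} (hx : 0 < x) (hs₀ : 0 ≤ s) (hs₁ : s ≤ 1) :
    (1 + x)⁻¹ ≤ x ^ (-s) := by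
  rw [Real.rpow_neg hx.le]
  refine inv_anti₀ (by positivity) ?_
  calc x ^ s ≤ (1 + x) ^ s := by gcongr; linarith
    _ ≤ (1 + x) ^ (1 : ℝ) := Real.rpow_le_rpow_of_exponent_le (by linarith) hs₁
    _ = 1 + x := Real.rpow_one _

/-- The backward Euler amplification factor at the first grid point after `t` decays like
`(1 + t * a)⁻¹`. -/
theorem inv_one_add_pow_floor_le {τ t a : ℝ} (hτ : 0 < τ) (ht : 0 ≤ t) (ha : 0 ≤ a) :
    ((1 + τ * a) ^ (⌊t / τ⌋₊ + 1))⁻¹ ≤ (1 + t * a)⁻¹ := by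
  refine inv_anti₀ (by positivity) ?_
  have hτa : 0 ≤ τ * a := by positivity
  have hk : t ≤ ((⌊t / τ⌋₊ + 1 : ℕ) : ℝ) * τ := by
    push_cast
    exact ((div_lt_iff₀ hτ).1 (Nat.lt_floor_add_one (t / τ))).le
  calc 1 + t * a ≤ 1 + ((⌊t / τ⌋₊ + 1 : ℕ) : ℝ) * τ * a := by gcongr
    _ = 1 + ((⌊t / τ⌋₊ + 1 : ℕ) : ℝ) * (τ * a) := by ring
    _ ≤ (1 + τ * a) ^ (⌊t / τ⌋₊ + 1) := one_add_mul_le_pow (by linarith) _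

theorem exp_neg_le_inv_one_add {x : ℝ} (hx : 0 ≤ x) : Real.exp (-x) ≤ (1 + x)⁻¹ := by
  rw [Real.exp_neg]
  refine inv_anti₀ (by positivity) ?_
  linarith [Real.add_one_le_exp x]

theorem fully_discrete_error_operator_i (ρ : ℝ) (hρ : ρ ∈ Set.Icc (0 : ℝ) 4) :
    ∃ C > (0 : ℝ), ∀ τ > (0 : ℝ), ∀ l > (0 : ℝ), ∀ t > (0 : ℝ),
      |Real.exp (-(t * l ^ 2)) - ((1 + τ * l ^ 2) ^ (⌊t / τ⌋₊ + 1))⁻¹|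
        ≤ C * t ^ (-(ρ / 4)) * l ^ (-(ρ / 2)) := by
  refine ⟨1, one_pos, fun τ hτ l hl t ht => ?_⟩
  have hx : 0 < t * l ^ 2 := by positivity
  have hrpow : (t * l ^ 2) ^ (-(ρ / 4)) = 1 * t ^ (-(ρ / 4)) * l ^ (-(ρ / 2)) := by
    rw [Real.mul_rpow ht.le (by positivity), ← Real.rpow_natCast l 2, ← Real.rpow_mul hl.le,
      one_mul]
    congr 2
    push_cast
    ring
  rw [← hrpow]
  refine le_trans ?_ (inv_one_add_le_rpow_neg hx (by linarith [hρ.1]) (by linarith [hρ.2]))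
  exact abs_sub_le_of_nonneg_of_le (Real.exp_pos _).le (exp_neg_le_inv_one_add hx.le)
    (by positivity) (inv_one_add_pow_floor_le hτ ht.le (sq_nonneg l))
end

section
/- For every β ∈ [0,4] there exists a constant C > 0 such that for all τ > 0, all λ > 0, and all t > 0 one has |ψ_{τ,λ}(t)| ≤ C · τ^{β/4} · λ^{β/2}, where ψ_{τ,λ}(t) = exp(−t·λ²) − (1 + τ·λ²)^{−k} with k = ⌊t/τ⌋ + 1. -/
open Real

theorem exp_sub_exp_le_mul (a b : ℝ) : exp (-a) - exp (-b) ≤ exp (-a) * (b - a) := by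
  have h : exp (-b) = exp (-a) * exp (-(b - a)) := by rw [← exp_add]; ring_nf
  have := mul_le_mul_of_nonneg_left (one_sub_le_exp_neg (b - a)) (exp_pos (-a)).le
  linarith

theorem mul_exp_neg_le_one (u : ℝ) : exp (-u) * u ≤ 1 := by
  have h := mul_le_mul_of_nonneg_left (add_one_le_exp u) (exp_pos (-u)).le
  rw [← exp_add, neg_add_cancel, exp_zero] at h
  linarith [exp_pos (-u)]

theorem exp_neg_nat_mul_le_inv_one_add_pow {x : ℝ} (hx : 0 < x) (k : ℕ) :
    exp (-(k * x)) ≤ ((1 + x) ^ k)⁻¹ := by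
  rw [exp_neg, exp_nat_mul]
  gcongr
  linarith [add_one_le_exp x]

theorem inv_one_add_pow_le_exp {x : ℝ} (hx : 0 < x) (k : ℕ) :
    ((1 + x) ^ k)⁻¹ ≤ exp (-(k * (x / (1 + x)))) := by
  have h := one_sub_le_exp_neg (x / (1 + x))
  have e : 1 - x / (1 + x) = (1 + x)⁻¹ := by field_simp; ring
  rw [e] at h
  rw [← mul_neg, exp_nat_mul, ← inv_pow]
  gcongr

/-- The backward Euler approximation of `exp (-(s * x))` at step `k`, where `k - 1 ≤ s ≤ k`,
has error at most `x`. -/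
theorem abs_exp_neg_sub_inv_one_add_pow_le {x s : ℝ} (hx : 0 < x) (hs : 0 ≤ s) {k : ℕ}
    (h1 : s ≤ k) (h2 : (k : ℝ) ≤ s + 1) :
    |exp (-(s * x)) - ((1 + x) ^ k)⁻¹| ≤ x := by
  rw [abs_le]
  constructor
  · have a := inv_one_add_pow_le_exp hx k
    have b := exp_sub_exp_le_mul (k * (x / (1 + x))) (k * x)
    have c := mul_le_mul_of_nonneg_right (mul_exp_neg_le_one (k * (x / (1 + x)))) hx.le
    have d : (k : ℝ) * x - k * (x / (1 + x)) = k * (x / (1 + x)) * x := by field_simp; ring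
    have e : exp (-(k * x)) ≤ exp (-(s * x)) := by gcongr
    rw [d, ← mul_assoc] at b
    linarith
  · have a := exp_neg_nat_mul_le_inv_one_add_pow hx k
    have b := exp_sub_exp_le_mul (s * x) (k * x)
    have c : exp (-(s * x)) ≤ 1 := exp_le_one_iff.2 (by simp only [neg_nonpos]; positivity)
    have d : exp (-(s * x)) * (k * x - s * x) ≤ 1 * (1 * x) := by
      rw [← sub_mul]
      exact mul_le_mul c (mul_le_mul_of_nonneg_right (by linarith) hx.le)
        (mul_nonneg (by linarith) hx.le) one_pos.le
    linarith

theorem abs_exp_neg_sub_inv_one_add_pow_le_one {x s : ℝ} (hx : 0 < x) (hs : 0 ≤ s) (k : ℕ) :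
    |exp (-(s * x)) - ((1 + x) ^ k)⁻¹| ≤ 1 := by
  have a : exp (-(s * x)) ≤ 1 := exp_le_one_iff.2 (by simp only [neg_nonpos]; positivity)
  have b : ((1 + x) ^ k)⁻¹ ≤ 1 := inv_le_one_of_one_le₀ (one_le_pow₀ (by linarith))
  have c : 0 < ((1 + x) ^ k)⁻¹ := by positivity
  rw [abs_le]
  constructor <;> linarith [exp_pos (-(s * x))]

theorem le_rpow_of_le_one_of_le {x y a : ℝ} (hx : 0 < x) (ha : 0 ≤ a) (ha' : a ≤ 1)
    (h1 : y ≤ 1) (h2 : y ≤ x) : y ≤ x ^ a := by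
  rcases le_total 1 x with h | h
  · exact h1.trans (one_le_rpow h ha)
  · exact h2.trans (by simpa using rpow_le_rpow_of_exponent_ge hx h ha')

theorem fully_discrete_error_operator_ii (β : ℝ) (hβ : β ∈ Set.Icc (0 : ℝ) 4) :
    ∃ C > (0 : ℝ), ∀ τ > (0 : ℝ), ∀ l > (0 : ℝ), ∀ t > (0 : ℝ),
      |Real.exp (-(t * l ^ 2)) - ((1 + τ * l ^ 2) ^ (⌊t / τ⌋₊ + 1))⁻¹|
        ≤ C * τ ^ (β / 4) * l ^ (β / 2) := by
  refine ⟨1, one_pos, fun τ hτ l hl t ht => ?_⟩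
  have hx : 0 < τ * l ^ 2 := by positivity
  have hs : 0 ≤ t / τ := by positivity
  have e : t * l ^ 2 = t / τ * (τ * l ^ 2) := by field_simp
  have r : 1 * τ ^ (β / 4) * l ^ (β / 2) = (τ * l ^ 2) ^ (β / 4) := by
    rw [mul_rpow hτ.le (by positivity), ← rpow_natCast l 2, ← rpow_mul hl.le, one_mul]
    congr 2
    push_cast
    ring
  rw [r, e]
  refine le_rpow_of_le_one_of_le hx (by linarith [hβ.1]) (by linarith [hβ.2])
    (abs_exp_neg_sub_inv_one_add_pow_le_one hx hs _)
    (abs_exp_neg_sub_inv_one_add_pow_le hx hs ?_ ?_)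
  · exact_mod_cast (Nat.lt_floor_add_one (t / τ)).le
  · push_cast
    linarith [Nat.floor_le hs]
end

section
/- For every α ∈ [0,4] there exists a constant C > 0 such that for all τ > 0, all λ > 0, and all t > 0 one has |ψ_{τ,λ}(t)| ≤ C · τ^{(4−α)/4} · t^{−1} · λ^{−α/2}, where ψ_{τ,λ}(t) = exp(−t·λ²) − (1 + τ·λ²)^{−k} with k = ⌊t/τ⌋ + 1. -/
open Real

/-- Mean value bound for `exp (-·)` on `[m, ∞)`. -/
theorem abs_exp_neg_sub_exp_neg_le {a b m D : ℝ} (ha : m ≤ a) (hb : m ≤ b)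
    (hD : |a - b| ≤ D) : |Real.exp (-a) - Real.exp (-b)| ≤ D * Real.exp (-m) := by
  have key : ∀ a b : ℝ, m ≤ a → |a - b| ≤ D →
      Real.exp (-a) - Real.exp (-b) ≤ D * Real.exp (-m) := by
    intro a b ha hD
    have h1 : Real.exp (-b) = Real.exp (-a) * Real.exp (a - b) := by
      rw [← Real.exp_add]; congr 1; ring
    have h2 := Real.add_one_le_exp (a - b)
    have h3 : Real.exp (-a) ≤ Real.exp (-m) := Real.exp_le_exp.mpr (by linarith)
    have h4 : b - a ≤ D := by linarith [neg_abs_le (a - b)]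
    have hD0 : 0 ≤ D := (abs_nonneg _).trans hD
    calc Real.exp (-a) - Real.exp (-b) = Real.exp (-a) * (1 - Real.exp (a - b)) := by
          rw [h1]; ring
      _ ≤ Real.exp (-a) * D := by gcongr; linarith
      _ ≤ Real.exp (-m) * D := by gcongr
      _ = D * Real.exp (-m) := mul_comm _ _
  rw [abs_le]
  constructor
  · linarith [key b a hb (by rwa [abs_sub_comm])]
  · exact key a b ha hD

/-- Error of `k` backward Euler steps against the exponential: the non-smooth-data bound,
for step size at most one. -/
theorem mul_abs_exp_sub_inv_pow_le_of_le_one {x s : ℝ} {k : ℕ} (hx : 0 < x) (hx1 : x ≤ 1)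
    (hs : 0 ≤ s) (hsk : s ≤ k) (hks : (k : ℝ) ≤ s + 1) :
    s * |Real.exp (-(s * x)) - ((1 + x) ^ k)⁻¹| ≤ 4 := by
  set y := Real.log (1 + x) with hy
  have hpow : ((1 + x) ^ k)⁻¹ = Real.exp (-(k * y)) := by
    rw [Real.exp_neg, Real.exp_nat_mul, Real.exp_log (by linarith)]
  have hyx : y ≤ x := by
    have := Real.log_le_sub_one_of_pos (show 0 < 1 + x by linarith)
    linarith
  have hxy : x - x ^ 2 / 2 ≤ y := by
    refine le_trans ?_ (Real.le_log_one_add_of_nonneg hx.le)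
    rw [le_div_iff₀ (by linarith)]
    nlinarith [pow_pos hx 3]
  have hxy2 : x / 2 ≤ y := by nlinarith
  have hm1 : s * x / 2 ≤ s * x := by nlinarith [mul_nonneg hs hx.le]
  have hsy : s * (x / 2) ≤ s * y := by gcongr
  have hky : s * y ≤ k * y := by
    have : 0 ≤ y := by linarith
    gcongr
  have hD : |s * x - k * y| ≤ s * x ^ 2 / 2 + x := by
    have h1 : s * (x - y) ≤ s * (x ^ 2 / 2) := by gcongr; linarith
    have h2 : 0 ≤ s * (x - y) := mul_nonneg hs (by linarith)
    have h3 : (k - s) * y ≤ 1 * x := by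
      apply mul_le_mul <;> linarith
    have h4 : 0 ≤ s * x ^ 2 := by positivity
    rw [abs_le]
    constructor <;> linarith
  have hmain := abs_exp_neg_sub_exp_neg_le (m := s * x / 2) hm1 (by linarith) hD
  rw [hpow]
  have hq := Real.quadratic_le_exp_of_nonneg (x := s * x / 2) (by positivity)
  calc s * |Real.exp (-(s * x)) - Real.exp (-(k * y))|
      ≤ s * ((s * x ^ 2 / 2 + x) * Real.exp (-(s * x / 2))) := by gcongr
    _ = (2 * (s * x / 2) ^ 2 + 2 * (s * x / 2)) * Real.exp (-(s * x / 2)) := by ring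
    _ ≤ (4 * Real.exp (s * x / 2)) * Real.exp (-(s * x / 2)) := by
        gcongr
        have : 0 ≤ s * x / 2 := by positivity
        linarith
    _ = 4 := by rw [mul_assoc, ← Real.exp_add]; simp

/-- Smoothing bound for the error, valid for every step size. -/
theorem mul_mul_abs_exp_sub_inv_pow_le_one {x s : ℝ} {k : ℕ} (hx : 0 < x)
    (hs : 0 ≤ s) (hsk : s ≤ k) :
    s * x * |Real.exp (-(s * x)) - ((1 + x) ^ k)⁻¹| ≤ 1 := by
  have hsx : 0 ≤ s * x := by positivity
  have h1 : s * x * Real.exp (-(s * x)) ≤ 1 := by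
    rw [Real.exp_neg, ← div_eq_mul_inv, div_le_one (Real.exp_pos _)]
    linarith [Real.add_one_le_exp (s * x)]
  have h2 : s * x * ((1 + x) ^ k)⁻¹ ≤ 1 := by
    rw [← div_eq_mul_inv, div_le_one (by positivity)]
    have := one_add_mul_le_pow (show (-2 : ℝ) ≤ x by linarith) k
    have : s * x ≤ k * x := by gcongr
    linarith
  have h3 : 0 ≤ s * x * Real.exp (-(s * x)) := by positivity
  have h4 : 0 ≤ s * x * ((1 + x) ^ k)⁻¹ := by positivity
  rw [← abs_of_nonneg hsx, ← abs_mul, abs_of_nonneg hsx, mul_sub, abs_le]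
  constructor <;> linarith

/-- Interpolation of the two previous bounds. -/
theorem mul_rpow_mul_abs_exp_sub_inv_pow_le {x s β : ℝ} {k : ℕ} (hx : 0 < x)
    (hs : 0 ≤ s) (hsk : s ≤ k) (hks : (k : ℝ) ≤ s + 1) (hβ0 : 0 ≤ β) (hβ1 : β ≤ 1) :
    s * x ^ β * |Real.exp (-(s * x)) - ((1 + x) ^ k)⁻¹| ≤ 4 := by
  rcases le_total x 1 with h | h
  · calc s * x ^ β * |Real.exp (-(s * x)) - ((1 + x) ^ k)⁻¹|
        ≤ s * 1 * |Real.exp (-(s * x)) - ((1 + x) ^ k)⁻¹| := by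
          gcongr
          exact Real.rpow_le_one hx.le h hβ0
      _ ≤ 4 := by
          rw [mul_one]
          exact mul_abs_exp_sub_inv_pow_le_of_le_one hx h hs hsk hks
  · calc s * x ^ β * |Real.exp (-(s * x)) - ((1 + x) ^ k)⁻¹|
        ≤ s * x * |Real.exp (-(s * x)) - ((1 + x) ^ k)⁻¹| := by
          gcongr
          simpa using Real.rpow_le_rpow_of_exponent_le h hβ1
      _ ≤ 4 := (mul_mul_abs_exp_sub_inv_pow_le_one hx hs hsk).trans (by norm_num)

theorem fully_discrete_error_operator_iii (α : ℝ) (hα : α ∈ Set.Icc (0 : ℝ) 4) :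
    ∃ C > (0 : ℝ), ∀ τ > (0 : ℝ), ∀ l > (0 : ℝ), ∀ t > (0 : ℝ),
      |Real.exp (-(t * l ^ 2)) - ((1 + τ * l ^ 2) ^ (⌊t / τ⌋₊ + 1))⁻¹|
        ≤ C * τ ^ ((4 - α) / 4) * t⁻¹ * l ^ (-(α / 2)) := by
  obtain ⟨hα0, hα4⟩ := hα
  refine ⟨4, by norm_num, fun τ hτ l hl t ht => ?_⟩
  have hs : 0 < t / τ := by positivity
  have h := mul_rpow_mul_abs_exp_sub_inv_pow_le (x := τ * l ^ 2) (s := t / τ) (β := α / 4)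
    (k := ⌊t / τ⌋₊ + 1) (by positivity) hs.le
    (by push_cast; exact (Nat.lt_floor_add_one _).le)
    (by push_cast; linarith [Nat.floor_le hs.le]) (by linarith) (by linarith)
  have hsx : t / τ * (τ * l ^ 2) = t * l ^ 2 := by field_simp
  have hw : t / τ * (τ * l ^ 2) ^ (α / 4) = (τ ^ ((4 - α) / 4) * t⁻¹ * l ^ (-(α / 2)))⁻¹ := by
    have h1 : (l ^ 2) ^ (α / 4) = l ^ (α / 2) := by
      rw [← Real.rpow_natCast, ← Real.rpow_mul hl.le]
      congr 1
      push_cast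
      ring
    have h2 : τ ^ ((4 - α) / 4) = τ / τ ^ (α / 4) := by
      rw [show (4 - α) / 4 = 1 - α / 4 by ring, Real.rpow_sub hτ, Real.rpow_one]
    rw [Real.mul_rpow hτ.le (by positivity), h1, h2, Real.rpow_neg hl.le]
    field_simp
  rw [hsx, hw, inv_mul_le_iff₀ (by positivity)] at h
  linarith
end

section
/- For every μ ∈ [0,4] there exists a constant C > 0 such that for all τ > 0, all λ > 0, and all t > 0 one has |ψ_{τ,λ}(t)| ≤ C · τ · t^{−(4−μ)/4} · λ^{μ/2}, where ψ_{τ,λ}(t) = exp(−t·λ²) − (1 + τ·λ²)^{−k} with k = ⌊t/τ⌋ + 1. -/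
open Real

lemma quadratic_le_one_add_pow {z : ℝ} (hz : 0 ≤ z) (n : ℕ) :
    1 + (n + 1) * z + n * (n + 1) / 2 * z ^ 2 ≤ (1 + z) ^ (n + 1) := by
  induction n with
  | zero => simp
  | succ n ih =>
    rw [pow_succ (1 + z)]
    have h := mul_le_mul_of_nonneg_right ih (by linarith : (0 : ℝ) ≤ 1 + z)
    have h3 : (0 : ℝ) ≤ n * (n + 1) / 2 * z ^ 3 := by positivity
    push_cast
    nlinarith

lemma inv_one_add_pow_sub_exp_le {z : ℝ} (hz : 0 ≤ z) (k : ℕ) :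
    ((1 + z) ^ k)⁻¹ - exp (-(k * z)) ≤ k * z ^ 2 / (1 + z) ^ k := by
  have hp : 0 < (1 + z) ^ k := by positivity
  have hb : 1 - z ≤ exp (-z) := by linarith [add_one_le_exp (-z)]
  have hbern := one_add_mul_le_pow (a := exp (-z) * (1 + z) - 1)
    (by nlinarith [mul_pos (exp_pos (-z)) (by linarith : 0 < 1 + z)]) k
  have hexp : exp (-(k * z)) = exp (-z) ^ k := by rw [← exp_nat_mul]; ring_nf
  rw [add_sub_cancel, mul_pow, ← hexp] at hbern
  have hlow : -z ^ 2 ≤ exp (-z) * (1 + z) - 1 := by nlinarith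
  have hmul := mul_le_mul_of_nonneg_left hlow (Nat.cast_nonneg (α := ℝ) k)
  rw [le_div_iff₀ hp, sub_mul, inv_mul_cancel₀ hp.ne']
  linarith

lemma inv_one_add_pow_sub_exp_le_self {z : ℝ} (hz : 0 ≤ z) (n : ℕ) :
    ((1 + z) ^ (n + 1))⁻¹ - exp (-((n + 1) * z)) ≤ z := by
  have h := inv_one_add_pow_sub_exp_le hz (n + 1)
  have hq := quadratic_le_one_add_pow hz n
  push_cast at h
  refine h.trans ?_
  rw [div_le_iff₀ (by positivity)]
  have h2 : (0 : ℝ) ≤ n * (n + 1) / 2 * z ^ 2 := by positivity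
  nlinarith [mul_le_mul_of_nonneg_left hq hz, mul_nonneg hz h2]

lemma inv_one_add_pow_sub_exp_le_div {z : ℝ} (hz : 0 ≤ z) (n : ℕ) :
    ((1 + z) ^ (n + 1))⁻¹ - exp (-((n + 1) * z)) ≤ 4 / (n + 1) := by
  rcases n.eq_zero_or_pos with rfl | hn
  · have h1 : ((1 + z) ^ (0 + 1))⁻¹ ≤ 1 := inv_le_one_of_one_le₀ (by simpa using hz)
    have h2 := exp_pos (-(((0 : ℕ) + 1 : ℝ) * z))
    norm_num at h1 h2 ⊢
    linarith
  · have h := inv_one_add_pow_sub_exp_le hz (n + 1)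
    have hq := quadratic_le_one_add_pow hz n
    have hn' : (1 : ℝ) ≤ n := by exact_mod_cast hn
    push_cast at h
    refine h.trans ?_
    rw [div_le_div_iff₀ (by positivity) (by positivity)]
    have h1 : (0 : ℝ) ≤ (n + 1) * z := by positivity
    have h2 : (0 : ℝ) ≤ (n - 1) * ((n + 1) * z ^ 2) :=
      mul_nonneg (by linarith) (by positivity)
    nlinarith

lemma exp_sub_inv_one_add_pow_le {z s : ℝ} (hz : 0 ≤ z) {n : ℕ} (hn : n ≤ s) :
    exp (-(s * z)) - ((1 + z) ^ (n + 1))⁻¹ ≤ z * exp (-(s * z)) := by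
  have hpow : (1 + z) ^ (n + 1) ≤ exp ((n + 1) * z) := by
    have h := pow_le_pow_left₀ (by linarith) (by linarith [add_one_le_exp z] : 1 + z ≤ exp z) (n + 1)
    rw [← exp_nat_mul] at h
    exact_mod_cast h
  have hinv : exp (-((n + 1) * z)) ≤ ((1 + z) ^ (n + 1))⁻¹ := by
    rw [exp_neg]
    exact inv_anti₀ (by positivity) hpow
  have hmono : exp (-(s * z)) * exp (-z) ≤ exp (-((n + 1) * z)) := by
    rw [← exp_add]
    exact exp_le_exp.mpr (by nlinarith)
  have h1 : 1 - z ≤ exp (-z) := by linarith [add_one_le_exp (-z)]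
  nlinarith [mul_le_mul_of_nonneg_left h1 (exp_pos (-(s * z))).le]

lemma abs_exp_sub_inv_one_add_pow_le {z s : ℝ} (hz : 0 ≤ z) (hs : 0 < s) :
    |exp (-(s * z)) - ((1 + z) ^ (⌊s⌋₊ + 1))⁻¹| ≤ 4 * z ∧
      |exp (-(s * z)) - ((1 + z) ^ (⌊s⌋₊ + 1))⁻¹| ≤ 4 / s := by
  have hlt := Nat.lt_floor_add_one s
  have hup := exp_sub_inv_one_add_pow_le hz (Nat.floor_le hs.le)
  have hexp : exp (-((⌊s⌋₊ + 1) * z)) ≤ exp (-(s * z)) := exp_le_exp.mpr (by nlinarith)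
  have hself := inv_one_add_pow_sub_exp_le_self hz ⌊s⌋₊
  have hdiv := inv_one_add_pow_sub_exp_le_div hz ⌊s⌋₊
  have hle : exp (-(s * z)) ≤ 1 := exp_le_one_iff.mpr (by nlinarith)
  have hdecay : z * exp (-(s * z)) ≤ 4 / s := by
    rw [le_div_iff₀ hs]
    have h : s * z * exp (-(s * z)) ≤ 1 := by
      rw [exp_neg, ← div_eq_mul_inv, div_le_one (exp_pos _)]
      linarith [add_one_le_exp (s * z)]
    linarith
  have hfloor : (4 : ℝ) / (⌊s⌋₊ + 1) ≤ 4 / s := by gcongr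
  constructor <;> rw [abs_le] <;> constructor <;> nlinarith

theorem fully_discrete_error_operator_iv (μ : ℝ) (hμ : μ ∈ Set.Icc (0 : ℝ) 4) :
    ∃ C > (0 : ℝ), ∀ τ > (0 : ℝ), ∀ l > (0 : ℝ), ∀ t > (0 : ℝ),
      |Real.exp (-(t * l ^ 2)) - ((1 + τ * l ^ 2) ^ (⌊t / τ⌋₊ + 1))⁻¹|
        ≤ C * τ * t ^ (-((4 - μ) / 4)) * l ^ (μ / 2) := by
  obtain ⟨hμ0, hμ4⟩ := hμ
  refine ⟨4, by norm_num, fun τ hτ l hl t ht => ?_⟩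
  obtain ⟨hsmooth, hrough⟩ := abs_exp_sub_inv_one_add_pow_le
    (z := τ * l ^ 2) (s := t / τ) (by positivity) (by positivity)
  rw [show t / τ * (τ * l ^ 2) = t * l ^ 2 by field_simp] at hsmooth hrough
  set e := |exp (-(t * l ^ 2)) - ((1 + τ * l ^ 2) ^ (⌊t / τ⌋₊ + 1))⁻¹|
  have he : 0 ≤ e := abs_nonneg _
  have hsum : (4 - μ) / 4 + μ / 4 = 1 := by ring
  calc e = e ^ ((4 - μ) / 4) * e ^ (μ / 4) := by
        rw [← rpow_add_of_nonneg he (by linarith) (by linarith), hsum, rpow_one]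
    _ ≤ (4 * τ * t⁻¹) ^ ((4 - μ) / 4) * (4 * τ * l ^ 2) ^ (μ / 4) := by
        gcongr
        · exact hrough.trans_eq (by field_simp)
        · linarith
    _ = (4 * τ) ^ ((4 - μ) / 4 + μ / 4) * t ^ (-((4 - μ) / 4)) * l ^ (μ / 2) := by
        rw [mul_rpow (y := t⁻¹) (by positivity) (by positivity),
          mul_rpow (y := l ^ 2) (by positivity) (by positivity),
          rpow_add (by positivity), inv_rpow ht.le, rpow_neg ht.le, ← rpow_natCast l 2,
          ← rpow_mul hl.le, show ((2 : ℕ) : ℝ) * (μ / 4) = μ / 2 by push_cast; ring]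
        ring
    _ = 4 * τ * t ^ (-((4 - μ) / 4)) * l ^ (μ / 2) := by rw [hsum, rpow_one]
end

section
/- For every δ ∈ [0,4] there exists a constant C > 0 such that for all τ > 0, all λ > 0, and all t > 0 one has |∫_0^t ψ_{τ,λ}(s) ds| ≤ C · τ^{(4−δ)/4} · λ^{−δ/2}, where ψ_{τ,λ}(s) = exp(−s·λ²) − (1 + τ·λ²)^{−k} with k = ⌊s/τ⌋ + 1. -/
open Real intervalIntegral

/-- The piecewise constant interpolation of the backward Euler factors is antitone in time. -/
lemma antitone_backwardEuler {τ x : ℝ} (hτ : 0 < τ) (hx : 0 ≤ x) :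
    Antitone fun s : ℝ => ((1 + x) ^ (⌊s / τ⌋₊ + 1))⁻¹ := by
  intro s u hsu
  have h : ⌊s / τ⌋₊ ≤ ⌊u / τ⌋₊ := Nat.floor_mono (by gcongr)
  have h1 : (1 : ℝ) ≤ 1 + x := by linarith
  dsimp only
  gcongr

lemma integral_backwardEuler_step {τ : ℝ} (hτ : 0 < τ) (x : ℝ) (n : ℕ) {u : ℝ}
    (hu : n * τ ≤ u) (hu' : u ≤ (n + 1) * τ) :
    ∫ s in (n * τ)..u, ((1 + x) ^ (⌊s / τ⌋₊ + 1))⁻¹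
      = (u - n * τ) * ((1 + x) ^ (n + 1))⁻¹ := by
  have h : ∫ s in (n * τ)..u, ((1 + x) ^ (⌊s / τ⌋₊ + 1))⁻¹
      = ∫ _ in (n * τ)..u, ((1 + x) ^ (n + 1))⁻¹ := by
    apply integral_congr_ae
    have hne : ∀ᵐ s : ℝ, s ≠ u := MeasureTheory.Measure.ae_ne _ u
    filter_upwards [hne] with s hs hmem
    rw [Set.uIoc_of_le hu] at hmem
    have hlt : s < u := lt_of_le_of_ne hmem.2 hs
    have hfloor : ⌊s / τ⌋₊ = n := by
      have hsn : (n : ℝ) ≤ s / τ := (le_div_iff₀ hτ).2 hmem.1.le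
      rw [Nat.floor_eq_iff ((Nat.cast_nonneg n).trans hsn)]
      exact ⟨hsn, (div_lt_iff₀ hτ).2 (hlt.trans_le hu')⟩
    rw [hfloor]
  rw [h, integral_const, smul_eq_mul]

/-- The integral of the backward Euler interpolation up to a grid point. -/
lemma integral_backwardEuler_grid {τ a : ℝ} (hτ : 0 < τ) (ha : 0 < a) (n : ℕ) :
    ∫ s in (0 : ℝ)..(n * τ), ((1 + τ * a) ^ (⌊s / τ⌋₊ + 1))⁻¹
      = (1 - ((1 + τ * a) ^ n)⁻¹) / a := by
  have hanti := antitone_backwardEuler hτ (mul_pos hτ ha).le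
  induction n with
  | zero => simp
  | succ n ih =>
    rw [← integral_add_adjacent_intervals (b := n * τ) hanti.intervalIntegrable
      hanti.intervalIntegrable, ih, Nat.cast_succ,
      integral_backwardEuler_step hτ _ n (by nlinarith) le_rfl]
    have h : 1 + τ * a ≠ 0 := by positivity
    field_simp
    ring

lemma integral_exp_neg_mul {a : ℝ} (ha : 0 < a) (t : ℝ) :
    ∫ s in (0 : ℝ)..t, exp (-(s * a)) = (1 - exp (-(t * a))) / a := by
  have h : ∀ s ∈ Set.uIcc 0 t,
      HasDerivAt (fun s => -(exp (-(s * a)) / a)) (exp (-(s * a))) s := by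
    intro s _
    have h1 := ((((hasDerivAt_id s).mul_const a).neg.exp).div_const a).neg
    refine h1.congr_deriv ?_
    simp only [id]
    field_simp
    simp [mul_comm]
  rw [integral_eq_sub_of_hasDerivAt h (Continuous.intervalIntegrable (by fun_prop) _ _)]
  simp
  ring

lemma exp_neg_le_inv_one_add_pow {x : ℝ} (hx : 0 < x) (n : ℕ) :
    exp (-(n * x)) ≤ ((1 + x) ^ n)⁻¹ := by
  rw [exp_neg, exp_nat_mul]
  gcongr
  linarith [add_one_le_exp x]

/-- Backward Euler error of order one, uniformly in the number of steps. -/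
lemma inv_one_add_pow_sub_exp_neg_le {x : ℝ} (hx : 0 < x) (n : ℕ) :
    ((1 + x) ^ n)⁻¹ - exp (-(n * x)) ≤ x := by
  suffices h : ((1 + x) ^ n)⁻¹ - exp (-(n * x)) ≤ n * x ^ 2 * ((1 + x) ^ n)⁻¹ by
    rcases n with _ | n
    · simp [hx.le]
    refine h.trans ?_
    rw [← div_eq_mul_inv, div_le_iff₀ (by positivity)]
    have hb := one_add_mul_le_pow (a := x) (by linarith) (n + 1)
    push_cast at hb ⊢
    nlinarith
  induction n with
  | zero => simp
  | succ n ih =>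
    have hr : (1 + x)⁻¹ - exp (-x) ≤ x ^ 2 * (1 + x)⁻¹ := by
      have h1 : (1 + x)⁻¹ * (1 + x) = 1 := inv_mul_cancel₀ (by positivity)
      nlinarith [add_one_le_exp (-x)]
    have he : exp (-((n + 1 : ℕ) * x)) = exp (-(n * x)) * exp (-x) := by
      rw [← exp_add]; push_cast; ring_nf
    have hle := exp_neg_le_inv_one_add_pow hx n
    have hr0 : 0 ≤ (1 + x)⁻¹ := by positivity
    have h1 := mul_le_mul_of_nonneg_right ih hr0
    have h2 := mul_le_mul_of_nonneg_left hr (exp_pos (-(n * x))).le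
    have h3 := mul_le_mul_of_nonneg_right hle (by positivity : 0 ≤ x ^ 2 * (1 + x)⁻¹)
    rw [he, pow_succ, mul_inv]
    push_cast
    linarith

lemma abs_integral_error_le {τ a t : ℝ} (hτ : 0 < τ) (ha : 0 < a) (ht : 0 < t) :
    |∫ s in (0 : ℝ)..t, (exp (-(s * a)) - ((1 + τ * a) ^ (⌊s / τ⌋₊ + 1))⁻¹)| ≤ 2 * τ ∧
    |∫ s in (0 : ℝ)..t, (exp (-(s * a)) - ((1 + τ * a) ^ (⌊s / τ⌋₊ + 1))⁻¹)| ≤ 2 * a⁻¹ := by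
  have hx : 0 < τ * a := mul_pos hτ ha
  have hanti := antitone_backwardEuler hτ hx.le
  set n := ⌊t / τ⌋₊
  have hn : n * τ ≤ t := (le_div_iff₀ hτ).1 (Nat.floor_le (by positivity))
  have hn' : t ≤ (n + 1) * τ := ((div_lt_iff₀ hτ).1 (Nat.lt_floor_add_one _)).le
  rw [integral_sub (Continuous.intervalIntegrable (by fun_prop) _ _) hanti.intervalIntegrable,
    integral_exp_neg_mul ha, ← integral_add_adjacent_intervals (b := n * τ)
      hanti.intervalIntegrable hanti.intervalIntegrable,
    integral_backwardEuler_grid hτ ha, integral_backwardEuler_step hτ _ n hn hn']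
  set p := ((1 + τ * a) ^ n)⁻¹ with hp
  have hp0 : 0 < p := by positivity
  have hp1 : p ≤ 1 := inv_le_one_of_one_le₀ (one_le_pow₀ (by linarith))
  have hq : ((1 + τ * a) ^ (n + 1))⁻¹ = p * (1 + τ * a)⁻¹ := by rw [pow_succ, mul_inv]
  rw [hq]
  set r := (1 + τ * a)⁻¹ with hr
  have hr0 : 0 < r := by positivity
  have hr1 : r ≤ 1 := inv_le_one_of_one_le₀ (by linarith)
  have hrx : r * (1 + τ * a) = 1 := inv_mul_cancel₀ (by positivity)
  have hlo := exp_neg_le_inv_one_add_pow hx n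
  have hup := inv_one_add_pow_sub_exp_neg_le hx n
  rw [← hp] at hlo hup
  have he0 := exp_pos (-(t * a))
  have hy0 : 0 ≤ t - n * τ := by linarith
  have hmono : exp (-(t * a)) ≤ exp (-(n * (τ * a))) := exp_le_exp.2 (by nlinarith)
  have hdiff : exp (-(n * (τ * a))) - exp (-(t * a)) ≤ (t - n * τ) * a := by
    have h1 : exp (-(t * a)) = exp (-(n * (τ * a))) * exp (-((t - n * τ) * a)) := by
      rw [← exp_add]; ring_nf
    have h2 : exp (-(n * (τ * a))) ≤ 1 := hlo.trans hp1
    have h3 := add_one_le_exp (-((t - n * τ) * a))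
    have h4 : 0 ≤ (t - n * τ) * a := by positivity
    nlinarith [exp_pos (-(n * (τ * a)))]
  have hpr0 : 0 < p * r := by positivity
  have hpr1 : p * r ≤ 1 := by nlinarith
  have hya : (t - n * τ) * a ≤ τ * a := by gcongr; linarith
  have hy : 0 ≤ (t - n * τ) * a := by positivity
  have hg0 : 0 ≤ (t - n * τ) * a * (p * r) := by positivity
  have hg1 : (t - n * τ) * a * (p * r) ≤ τ * a := by nlinarith
  have hg2 : (t - n * τ) * a * (p * r) ≤ p := by
    calc (t - n * τ) * a * (p * r) ≤ τ * a * (p * r) := by gcongr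
      _ = p * (r * (1 + τ * a)) - p * r := by ring
      _ ≤ p := by rw [hrx]; linarith
  have hD : (1 - exp (-(t * a))) / a - ((1 - p) / a + (t - n * τ) * (p * r))
      = (p - exp (-(t * a)) - (t - n * τ) * a * (p * r)) / a := by
    field_simp
    ring
  rw [hD, abs_div, abs_of_pos ha, div_le_iff₀ ha, div_le_iff₀ ha, abs_le, abs_le,
    inv_mul_cancel_right₀ ha.ne']
  refine ⟨⟨?_, ?_⟩, ?_, ?_⟩ <;> linarith

/-- A quantity bounded by two others is bounded by their weighted geometric means. -/
lemma le_rpow_mul_rpow_of_le {d u v θ : ℝ} (hd : 0 ≤ d) (hu : d ≤ u) (hv : d ≤ v)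
    (h0 : 0 ≤ θ) (h1 : θ ≤ 1) : d ≤ u ^ (1 - θ) * v ^ θ := by
  calc d = d ^ (1 - θ) * d ^ θ := by
        rw [← rpow_add' hd (by norm_num), sub_add_cancel, rpow_one]
    _ ≤ u ^ (1 - θ) * v ^ θ := by
        have : 0 ≤ u := hd.trans hu
        have : 0 ≤ 1 - θ := by linarith
        gcongr

theorem fully_discrete_error_operator_vi (δ : ℝ) (hδ : δ ∈ Set.Icc (0 : ℝ) 4) :
    ∃ C > (0 : ℝ), ∀ τ > (0 : ℝ), ∀ l > (0 : ℝ), ∀ t > (0 : ℝ),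
      |∫ s in (0 : ℝ)..t,
          (Real.exp (-(s * l ^ 2)) - ((1 + τ * l ^ 2) ^ (⌊s / τ⌋₊ + 1))⁻¹)|
        ≤ C * τ ^ ((4 - δ) / 4) * l ^ (-(δ / 2)) := by
  refine ⟨2, two_pos, fun τ hτ l hl t ht => ?_⟩
  obtain ⟨h1, h2⟩ := abs_integral_error_le hτ (pow_pos hl 2) ht
  refine (le_rpow_mul_rpow_of_le (abs_nonneg _) h1 h2 (θ := δ / 4)
    (by linarith [hδ.1]) (by linarith [hδ.2])).trans_eq ?_
  have hl2 : ((l ^ 2)⁻¹ : ℝ) ^ (δ / 4) = l ^ (-(δ / 2)) := by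
    rw [inv_rpow (by positivity), ← rpow_neg (by positivity), ← rpow_natCast,
      ← rpow_mul hl.le]
    congr 1
    push_cast
    ring
  have h22 : (2 : ℝ) ^ (1 - δ / 4) * 2 ^ (δ / 4) = 2 := by
    rw [← rpow_add two_pos, sub_add_cancel, rpow_one]
  rw [mul_rpow two_pos.le hτ.le, mul_rpow two_pos.le (by positivity), hl2,
    show (4 - δ) / 4 = 1 - δ / 4 by ring]
  calc _ = ((2 : ℝ) ^ (1 - δ / 4) * 2 ^ (δ / 4)) * τ ^ (1 - δ / 4) * l ^ (-(δ / 2)) := by ring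
    _ = _ := by rw [h22]
end
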